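/- Let A₁, …, A_N be n×n positive definite complex matrices, let ω = (w₁, …, w_N) be a positive probability vector, and let q satisfy 0 < q ≤ 1. Then Q_q(ω; A₁, …, A_N) ⪯ 𝒜(ω; A₁, …, A_N) in the near-order, where 𝒜(ω; A₁, …, A_N) = Σⱼ wⱼ Aⱼ is the weighted arithmetic mean. -/

import Mathlib

open Matrix
open scoped ComplexOrder

/-- Real power of a matrix via functional calculus on the spectrum (junk value
if the matrix is not Hermitian). -/
noncomputable def mrpow {n : ℕ} (A : Matrix (Fin n) (Fin n) ℂ) (r : ℝ) :
    Matrix (Fin n) (Fin n) ℂ :=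
  if hA : A.IsHermitian then
    (hA.eigenvectorUnitary : Matrix (Fin n) (Fin n) ℂ) *
      diagonal (fun i => ((hA.eigenvalues i ^ r : ℝ) : ℂ)) *
      (star (hA.eigenvectorUnitary : Matrix (Fin n) (Fin n) ℂ))
  else A

/-- The metric geometric mean `A # B = A^{1/2} (A^{-1/2} B A^{-1/2})^{1/2} A^{1/2}`. -/
noncomputable def sharp {n : ℕ} (A B : Matrix (Fin n) (Fin n) ℂ) :
    Matrix (Fin n) (Fin n) ℂ :=
  mrpow A (1/2) * mrpow (mrpow A (-(1/2)) * B * mrpow A (-(1/2))) (1/2) * mrpow A (1/2)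

/-- The Loewner order `A ≤ B`, i.e. `B - A` is positive semidefinite. -/
def loewnerLE {n : ℕ} (A B : Matrix (Fin n) (Fin n) ℂ) : Prop := (B - A).PosSemidef

/-- The near-order `A ⪯ B`, i.e. `A⁻¹ # B ≥ I` in the Loewner order. -/
def nearLE {n : ℕ} (A B : Matrix (Fin n) (Fin n) ℂ) : Prop := loewnerLE 1 (sharp A⁻¹ B)

/-- The quasi-arithmetic mean `Q_p(ω; A₁, …, A_N) = (Σⱼ wⱼ Aⱼ^p)^{1/p}`. -/
noncomputable def quasiArith {n N : ℕ} (w : Fin N → ℝ) (p : ℝ)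
    (A : Fin N → Matrix (Fin n) (Fin n) ℂ) : Matrix (Fin n) (Fin n) ℂ :=
  mrpow (∑ j, w j • mrpow (A j) p) (1/p)

open scoped MatrixOrder Matrix.Norms.L2Operator

section abstract_part

variable {𝔸 : Type*} [CStarAlgebra 𝔸] [PartialOrder 𝔸] [StarOrderedRing 𝔸]

/-- Half powers of a strictly positive element. -/
lemma half_powers (B : 𝔸) (hB : IsStrictlyPositive B) :
    ∃ R R' : 𝔸, R = B ^ (1/2 : ℝ) ∧ R' = B ^ (-(1/2) : ℝ) ∧
      0 ≤ R ∧ 0 ≤ R' ∧ R * R' = 1 ∧ R' * R = 1 ∧ R * R = B := by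
  have hu : IsUnit B := hB.isUnit
  have h0 : 0 ≤ B := hB.nonneg
  refine ⟨_, _, rfl, rfl, CFC.rpow_nonneg, CFC.rpow_nonneg, ?_, ?_, ?_⟩
  · rw [← CFC.rpow_add hu]; simp [CFC.rpow_zero B]
  · rw [← CFC.rpow_add hu]; simp [CFC.rpow_zero B]
  · rw [← CFC.rpow_add hu]; norm_num [CFC.rpow_one B]

lemma conj_le {R X Y : 𝔸} (hR : 0 ≤ R) (h : X ≤ Y) : R * X * R ≤ R * Y * R :=
  (IsSelfAdjoint.of_nonneg hR).conjugate_le_conjugate h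

lemma conj_nn {R X : 𝔸} (hR : 0 ≤ R) (h : 0 ≤ X) : 0 ≤ R * X * R :=
  (IsSelfAdjoint.of_nonneg hR).conjugate_nonneg h

lemma riccati_mono {B X Y : 𝔸} (hB : IsStrictlyPositive B) (hX : 0 ≤ X) (hY : 0 ≤ Y)
    (h : X * B * X ≤ Y * B * Y) : X ≤ Y := by
  obtain ⟨R, R', -, -, hR, hR', h1, h2, h3⟩ := half_powers B hB
  have key : (R * X * R) * (R * X * R) ≤ (R * Y * R) * (R * Y * R) := by
    have e : ∀ Z : 𝔸, (R * Z * R) * (R * Z * R) = R * (Z * B * Z) * R := by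
      intro Z; rw [← h3]; simp only [mul_assoc]
    rw [e, e]; exact conj_le hR h
  have k2 := CFC.sqrt_le_sqrt _ _ key
  rw [CFC.sqrt_mul_self _ (conj_nn hR hX), CFC.sqrt_mul_self _ (conj_nn hR hY)] at k2
  have k3 := conj_le hR' k2
  have e : ∀ Z : 𝔸, R' * (R * Z * R) * R' = Z := by
    intro Z
    calc R' * (R * Z * R) * R' = (R' * R) * Z * (R * R') := by simp only [mul_assoc]
      _ = Z := by rw [h1, h2]; simp
  rwa [e, e] at k3

lemma riccati_exists {B A : 𝔸} (hB : IsStrictlyPositive B) (hA : 0 ≤ A) :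
    ∃ H : 𝔸, 0 ≤ H ∧ H * B * H = A := by
  obtain ⟨R, R', -, -, hR, hR', h1, h2, h3⟩ := half_powers B hB
  have hC : 0 ≤ R * A * R := conj_nn hR hA
  refine ⟨R' * CFC.sqrt (R * A * R) * R', conj_nn hR' (CFC.sqrt_nonneg _), ?_⟩
  have hs := CFC.sqrt_mul_sqrt_self (R * A * R) hC
  set S := CFC.sqrt (R * A * R)
  calc R' * S * R' * B * (R' * S * R') = R' * S * (R' * R) * (R * R') * S * R' := by
        rw [← h3]; simp only [mul_assoc]
    _ = R' * (S * S) * R' := by rw [h1, h2]; simp [mul_assoc]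
    _ = (R' * R) * A * (R * R') := by rw [hs]; simp only [mul_assoc]
    _ = A := by rw [h1, h2]; simp

lemma doubling (k : ℕ) {B A : 𝔸} (hB : IsStrictlyPositive B) (hA : 0 ≤ A) (hBA : B ≤ A) :
    ∀ H : 𝔸, 0 ≤ H → H * B ^ (2 ^ k) * H = A ^ (2 ^ k) → 1 ≤ H := by
  have hpow : ∀ m : ℕ, IsStrictlyPositive (B ^ m) := fun m =>
    (hB.isUnit.pow m).isStrictlyPositive (CStarAlgebra.pow_nonneg hB.nonneg m)
  induction k with
  | zero =>
    intro H hH h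
    refine riccati_mono hB zero_le_one hH ?_
    simp only [pow_zero, pow_one] at h
    rw [h]; simpa using hBA
  | succ k ih =>
    intro K hK h
    obtain ⟨H, hH, hH2⟩ := riccati_exists (hpow (2 ^ k)) (CStarAlgebra.pow_nonneg hA (2 ^ k))
    have h1 := ih H hH hH2
    refine h1.trans (riccati_mono (hpow (2 ^ (k+1))) hH hK ?_)
    rw [h, pow_succ, pow_mul, pow_mul, ← hH2]
    have hHH : (1 : 𝔸) ≤ H * H := by
      have h0 : 0 ≤ H - 1 := sub_nonneg.2 h1
      have hsq : 0 ≤ (H - 1) * (H - 1) := by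
        simpa using conj_nn h0 (zero_le_one : (0 : 𝔸) ≤ 1)
      have : H * H - 1 = (H - 1) * (H - 1) + (H - 1) + (H - 1) := by noncomm_ring
      rw [← sub_nonneg, this]
      exact add_nonneg (add_nonneg hsq h0) h0
    have hb := CStarAlgebra.pow_nonneg hB.nonneg (2 ^ k)
    have := conj_le hH (conj_le hb hHH)
    calc H * (B ^ 2 ^ k) ^ 2 * H = H * (B ^ 2 ^ k * 1 * B ^ 2 ^ k) * H := by
          rw [pow_two, mul_one]
      _ ≤ _ := this
      _ = (H * B ^ 2 ^ k * H) ^ 2 := by rw [pow_two]; simp only [mul_assoc]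

lemma near_abstract {Q T H : 𝔸} (hQ : IsStrictlyPositive Q) (hT : IsStrictlyPositive T)
    {q : ℝ} (hq0 : 0 < q) (h : Q ^ q ≤ T ^ q) (hH : 0 ≤ H) (hr : H * Q * H = T) : 1 ≤ H := by
  obtain ⟨k, hk⟩ := exists_pow_lt_of_lt_one hq0 (by norm_num : (1/2 : ℝ) < 1)
  set s : ℝ := (1/2) ^ k with hs
  have hs0 : 0 < s := by positivity
  have hs1 : s * ((2 ^ k : ℕ) : ℝ) = 1 := by
    rw [hs]; push_cast; rw [← mul_pow]; norm_num
  have e : ∀ Z : 𝔸, IsStrictlyPositive Z → (Z ^ q) ^ (s / q) = Z ^ s := by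
    intro Z hZ
    rw [CFC.rpow_rpow Z q (s / q) hq0.ne' hZ]
    congr 1; field_simp
  have e2 : ∀ Z : 𝔸, IsStrictlyPositive Z → (Z ^ s) ^ (2 ^ k) = Z := by
    intro Z hZ
    rw [← CFC.rpow_natCast _ _ CFC.rpow_nonneg,
      CFC.rpow_rpow Z s _ hs0.ne' hZ, hs1, CFC.rpow_one Z hZ.nonneg]
  have h2 : Q ^ s ≤ T ^ s := by
    rw [← e Q hQ, ← e T hT]
    exact CFC.rpow_le_rpow ⟨by positivity, by rw [div_le_one hq0]; exact hk.le⟩ h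
  refine doubling k (B := Q ^ s) (A := T ^ s) (IsStrictlyPositive.rpow _ s hQ) CFC.rpow_nonneg h2 H hH ?_
  rw [e2 Q hQ, e2 T hT, hr]

end abstract_part

lemma mrpow_eq {n : ℕ} {A : Matrix (Fin n) (Fin n) ℂ} (hA : A.PosSemidef) (r : ℝ) :
    mrpow A r = A ^ r := by
  have h0 : 0 ≤ A := Matrix.nonneg_iff_posSemidef.2 hA
  rw [CFC.rpow_eq_cfc_real h0, hA.isHermitian.cfc_eq, mrpow, dif_pos hA.isHermitian]
  simp [Matrix.IsHermitian.cfc, Unitary.conjStarAlgAut_apply, Function.comp_def]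

lemma sharp_riccati {n : ℕ} {P A : Matrix (Fin n) (Fin n) ℂ} (hP : P.PosDef)
    (hA : A.PosDef) : 0 ≤ sharp P A ∧ sharp P A * P⁻¹ * sharp P A = A := by
  have hA0 : 0 ≤ A := Matrix.nonneg_iff_posSemidef.2 hA.posSemidef
  obtain ⟨R, R', e1, e2, hR, hR', h1, h2, h3⟩ :=
    half_powers P (Matrix.isStrictlyPositive_iff_posDef.2 hP)
  have hC : 0 ≤ R' * A * R' := conj_nn hR' hA0
  have hS : sharp P A = R * CFC.sqrt (R' * A * R') * R := by
    rw [sharp, mrpow_eq hP.posSemidef, mrpow_eq hP.posSemidef, ← e1, ← e2,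
      mrpow_eq (Matrix.nonneg_iff_posSemidef.1 hC), CFC.sqrt_eq_rpow]
  have hinv : P⁻¹ = R' * R' := by
    apply Matrix.inv_eq_right_inv
    calc P * (R' * R') = R * (R * R') * R' := by rw [← h3]; simp only [mul_assoc]
      _ = 1 := by rw [h1, mul_one, h1]
  have hs := CFC.sqrt_mul_sqrt_self (R' * A * R') hC
  rw [hS, hinv]
  refine ⟨conj_nn hR (CFC.sqrt_nonneg _), ?_⟩
  set S := CFC.sqrt (R' * A * R')
  calc R * S * R * (R' * R') * (R * S * R) = R * S * (R * R') * (R' * R) * S * R := by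
        simp only [mul_assoc]
    _ = R * (S * S) * R := by rw [h1, h2]; simp [mul_assoc]
    _ = (R * R') * A * (R' * R) := by rw [hs]; simp only [mul_assoc]
    _ = A := by rw [h1, h2]; simp

lemma sum_posDef {n N : ℕ}
    (A : Fin N → Matrix (Fin n) (Fin n) ℂ) (hA : ∀ j, (A j).PosDef)
    (w : Fin N → ℝ) (hw : ∀ j, 0 < w j) (hw1 : ∑ j, w j = 1) :
    (∑ j, w j • A j).PosDef := by
  have hN : (Finset.univ : Finset (Fin N)).Nonempty := by
    by_contra h
    rw [Finset.not_nonempty_iff_eq_empty] at h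
    rw [h] at hw1; simp at hw1
  exact Matrix.posDef_sum hN fun j _ => (hA j).smul (hw j)

theorem quasiArith_nearLE_arith {n N : ℕ}
    (A : Fin N → Matrix (Fin n) (Fin n) ℂ) (hA : ∀ j, (A j).PosDef)
    (w : Fin N → ℝ) (hw : ∀ j, 0 < w j) (hw1 : ∑ j, w j = 1)
    (q : ℝ) (hq0 : 0 < q) (hq1 : q ≤ 1) :
    nearLE (quasiArith w q A) (∑ j, w j • A j) := by
  have hsp : ∀ j, IsStrictlyPositive (A j) := fun j =>
    Matrix.isStrictlyPositive_iff_posDef.2 (hA j)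
  have hT := sum_posDef A hA w hw hw1
  have hS := sum_posDef (fun j => A j ^ q)
    (fun j => Matrix.isStrictlyPositive_iff_posDef.1 (IsStrictlyPositive.rpow _ q (hsp j))) w hw hw1
  have hS' := Matrix.isStrictlyPositive_iff_posDef.2 hS
  have hQe : quasiArith w q A = (∑ j, w j • A j ^ q) ^ (1 / q) := by
    rw [quasiArith]
    simp_rw [fun j => mrpow_eq (hA j).posSemidef q]
    exact mrpow_eq hS.posSemidef _
  have hQs : IsStrictlyPositive (quasiArith w q A) := by rw [hQe]; exact IsStrictlyPositive.rpow _ _ hS'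
  have hQ := Matrix.isStrictlyPositive_iff_posDef.1 hQs
  have hle : quasiArith w q A ^ q ≤ (∑ j, w j • A j) ^ q := by
    rw [hQe, CFC.rpow_rpow _ (1 / q) q (by positivity) hS',
      one_div_mul_cancel hq0.ne', CFC.rpow_one _ hS'.nonneg]
    exact (CFC.concaveOn_rpow ⟨hq0.le, hq1⟩).le_map_sum (fun j _ => (hw j).le) hw1
      (fun j _ => (hsp j).nonneg)
  obtain ⟨h0, h1⟩ := sharp_riccati hQ.inv hT
  rw [Matrix.nonsing_inv_nonsing_inv _ ((Matrix.isUnit_iff_isUnit_det _).1 hQ.isUnit)] at h1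
  exact near_abstract hQs (Matrix.isStrictlyPositive_iff_posDef.2 hT) hq0 hle h0 h1
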